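/- Let A be a noetherian local ring. Then A is almost Cohen-Macaulay if and only if the formal power series ring A[[X]] is almost Cohen-Macaulay. -/

import Mathlib

open IsLocalRing

/-- The `I`-depth (grade) of an `A`-module `M`: the supremum of lengths of
`M`-regular sequences with entries in `I`. -/
noncomputable def idealDepth {A : Type*} [CommRing A] (I : Ideal A)
    (M : Type*) [AddCommGroup M] [Module A M] : ℕ∞ :=
  sSup {n : ℕ∞ | ∃ rs : List A, (rs.length : ℕ∞) = n ∧ (∀ r ∈ rs, r ∈ I) ∧
    RingTheory.Sequence.IsRegular M rs}

/-- The depth of a local ring: the depth with respect to its maximal ideal. -/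
noncomputable def ringDepth (A : Type*) [CommRing A] [IsLocalRing A] : ℕ∞ :=
  idealDepth (IsLocalRing.maximalIdeal A) A

/-- depth(A_P), the depth of the localization of `A` at the prime `P`. -/
noncomputable def localDepth {A : Type*} [CommRing A] (P : Ideal A) [P.IsPrime] : ℕ∞ :=
  ringDepth (Localization.AtPrime P)

/-- The height of a prime ideal. -/
noncomputable def primeHeight {A : Type*} [CommRing A] (P : Ideal A) [P.IsPrime] : ℕ∞ :=
  Order.height (⟨P, inferInstance⟩ : PrimeSpectrum A)

/-- A noetherian local ring is almost Cohen-Macaulay if `dim A ≤ 1 + depth A`. -/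
def IsAlmostCM (A : Type*) [CommRing A] [IsLocalRing A] : Prop :=
  ringKrullDim A ≤ ((1 + ringDepth A : ℕ∞) : WithBot ℕ∞)

/-- Almost Cohen-Macaulay for a (local) ring presented with an explicit maximal ideal `I`:
`dim R ≤ 1 + depth_I R`. -/
def IsAlmostCMWith (R : Type*) [CommRing R] (I : Ideal R) : Prop :=
  ringKrullDim R ≤ ((1 + idealDepth I R : ℕ∞) : WithBot ℕ∞)

/-- A ring is almost Cohen-Macaulay (Han/Kang) if `depth_P A = depth (A_P)` for all primes. -/
def IsACM (A : Type*) [CommRing A] : Prop :=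
  ∀ (P : Ideal A) [P.IsPrime], idealDepth P A = localDepth P

/-- Serre's condition `(S_k)`: `depth A_P ≥ min (ht P, k)` for all primes `P`. -/
def SerreCond (k : ℕ) (A : Type*) [CommRing A] : Prop :=
  ∀ (P : Ideal A) [P.IsPrime], min (primeHeight P) (k : ℕ∞) ≤ localDepth P

/-- The condition `(C_k)`: `depth A_P ≥ min (ht P, k) - 1` for all primes `P`. -/
def CondC (k : ℕ) (A : Type*) [CommRing A] : Prop :=
  ∀ (P : Ideal A) [P.IsPrime], min (primeHeight P) (k : ℕ∞) ≤ 1 + localDepth P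

open RingTheory.Sequence Pointwise in
/-- If `f : R → S` is surjective with kernel generated by `x`, then regularity of a sequence on
`R / xR` is the same as regularity of its image on `S`. -/
lemma isRegular_quotSMulTop_iff_map {R S : Type*} [CommRing R] [CommRing S] {f : R →+* S}
    (hf : Function.Surjective f) {x : R} (hx : RingHom.ker f = Ideal.span {x}) (rs : List R) :
    IsRegular (QuotSMulTop x R) rs ↔ IsRegular S (rs.map f) := by
  have h : x • (⊤ : Submodule R R) = RingHom.ker f := by
    rw [hx, ← Submodule.ideal_span_singleton_smul, smul_eq_mul, Ideal.mul_top]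
  let e : QuotSMulTop x R ≃+ S :=
    (Submodule.quotEquivOfEq _ _ h).toAddEquiv.trans
      (RingHom.quotientKerEquivOfSurjective hf).toAddEquiv
  refine AddEquiv.isRegular_congr (e := e) (List.forall₂_map_right_iff.mpr <|
    List.forall₂_same.mpr fun r _ y ↦ ?_)
  obtain ⟨y, rfl⟩ := Submodule.Quotient.mk_surjective _ y
  exact map_mul f r y

open CategoryTheory Abelian Limits RingTheory.Sequence IsSMulRegular in
/-- Over a Noetherian local ring, if the maximal ideal contains a regular sequence of length
`n + 1` on a finite module `M`, then it contains one of length `n` on `M / xM` for every regular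
element `x` of the maximal ideal. -/
lemma exists_isRegular_quotSMulTop.{u} {R : Type u} [CommRing R] [IsNoetherianRing R]
    [IsLocalRing R] {M : Type u} [AddCommGroup M] [Module R M] [Module.Finite R M] {x : R}
    (hx : IsSMulRegular M x) (hxm : x ∈ maximalIdeal R) {n : ℕ} {rs : List R}
    (hlen : rs.length = n + 1) (hmem : ∀ r ∈ rs, r ∈ maximalIdeal R) (hrs : IsRegular M rs) :
    ∃ rs' : List R, rs'.length = n ∧ (∀ r ∈ rs', r ∈ maximalIdeal R) ∧
      IsRegular (QuotSMulTop x M) rs' := by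
  have : Nontrivial M := hrs.nontrivial
  have : Nontrivial (QuotSMulTop x M) := nontrivial_quotSMulTop_of_mem_maximalIdeal M hxm
  have smul_lt (N : Type u) [AddCommGroup N] [Module R N] [Module.Finite R N] [Nontrivial N] :
      maximalIdeal R • (⊤ : Submodule R N) < ⊤ :=
    (Submodule.top_ne_ideal_smul_of_le_jacobson_annihilator
      (maximalIdeal_le_jacobson _)).symm.lt_top
  have suppQ : Module.support R (R ⧸ maximalIdeal R) =
      PrimeSpectrum.zeroLocus (maximalIdeal R) := by
    rw [Module.support_eq_zeroLocus, Ideal.annihilator_quotient]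
  have hM := ModuleCat.subsingleton_ext_of_exists_isRegular (maximalIdeal R)
    (ModuleCat.of R (R ⧸ maximalIdeal R)) suppQ.subset (ModuleCat.of R M) (smul_lt M) rs hmem hrs
  refine ModuleCat.exists_isRegular_of_exists_subsingleton_ext (maximalIdeal R) n
    (ModuleCat.of R (QuotSMulTop x M)) (smul_lt _) (ModuleCat.of R (R ⧸ maximalIdeal R)) suppQ
    fun i hi ↦ ?_
  have zero1 := AddCommGrpCat.isZero_of_iff_subsingleton.mpr (hM i (by omega))
  have zero2 := AddCommGrpCat.isZero_of_iff_subsingleton.mpr (hM (i + 1) (by omega))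
  have hS := smulShortComplex_shortExact (M := ModuleCat.of R M) hx
  exact AddCommGrpCat.subsingleton_of_isZero <| ShortComplex.Exact.isZero_of_both_zeros
    (Ext.covariant_sequence_exact₃' _ hS i (i + 1) rfl)
    (zero1.eq_zero_of_src _) (zero2.eq_zero_of_tgt _)

lemma length_le_idealDepth {R M : Type*} [CommRing R] [AddCommGroup M] [Module R M] {I : Ideal R}
    {rs : List R} (hmem : ∀ r ∈ rs, r ∈ I) (hrs : RingTheory.Sequence.IsRegular M rs) :
    (rs.length : ℕ∞) ≤ idealDepth I M :=
  le_sSup ⟨rs, rfl, hmem, hrs⟩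

namespace PowerSeries

lemma ker_constantCoeff_eq_span_X (R : Type*) [CommRing R] :
    RingHom.ker (constantCoeff (R := R)) = Ideal.span {X} := by
  ext φ
  rw [RingHom.mem_ker, Ideal.mem_span_singleton, X_dvd_iff]

lemma constantCoeff_mem_maximalIdeal_iff {R : Type*} [CommRing R] [IsLocalRing R]
    {φ : PowerSeries R} :
    constantCoeff φ ∈ maximalIdeal R ↔ φ ∈ maximalIdeal (PowerSeries R) := by
  rw [mem_maximalIdeal, mem_maximalIdeal, mem_nonunits_iff, mem_nonunits_iff,
    isUnit_iff_constantCoeff]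

lemma X_mem_maximalIdeal (R : Type*) [CommRing R] [IsLocalRing R] :
    (X : PowerSeries R) ∈ maximalIdeal (PowerSeries R) := by
  rw [← constantCoeff_mem_maximalIdeal_iff, constantCoeff_X]
  exact zero_mem _

lemma isSMulRegular_X (R : Type*) [CommRing R] :
    IsSMulRegular (PowerSeries R) (X : PowerSeries R) :=
  fun _ _ h ↦ X_mul_cancel h

lemma ringKrullDim_eq_add_one (R : Type*) [CommRing R] [IsNoetherianRing R] [IsLocalRing R] :
    ringKrullDim (PowerSeries R) = ringKrullDim R + 1 := by
  rw [← ringKrullDim_quotient_span_singleton_succ_eq_ringKrullDim (isSMulRegular_X R)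
    (X_mem_maximalIdeal R), ← ker_constantCoeff_eq_span_X,
    ringKrullDim_eq_of_ringEquiv (RingHom.quotientKerEquivOfSurjective constantCoeff_surj)]

open RingTheory.Sequence in
lemma ringDepth_eq_add_one (R : Type*) [CommRing R] [IsNoetherianRing R] [IsLocalRing R] :
    ringDepth (PowerSeries R) = ringDepth R + 1 := by
  have key (rs : List (PowerSeries R)) :=
    isRegular_quotSMulTop_iff_map constantCoeff_surj (ker_constantCoeff_eq_span_X R) rs
  apply le_antisymm
  · refine sSup_le ?_
    rintro _ ⟨rs, rfl, hmem, hrs⟩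
    rcases hlen : rs.length with _ | n
    · simp
    obtain ⟨rs', hlen', hmem', hrs'⟩ := exists_isRegular_quotSMulTop (isSMulRegular_X R)
      (X_mem_maximalIdeal R) hlen hmem hrs
    rw [Nat.cast_add_one]
    gcongr
    rw [← hlen', ← List.length_map (as := rs') constantCoeff]
    refine length_le_idealDepth ?_ ((key rs').mp hrs')
    simpa only [List.forall_mem_map, constantCoeff_mem_maximalIdeal_iff] using hmem'
  · rw [ringDepth, idealDepth, ENat.sSup_add]
    swap; · exact ⟨0, [], rfl, by simp, .nil R R⟩
    refine iSup₂_le ?_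
    rintro _ ⟨rs, rfl, hmem, hrs⟩
    refine le_trans (by simp) (length_le_idealDepth (rs := X :: rs.map C) ?_
      (.cons (isSMulRegular_X R) ?_))
    · refine List.forall_mem_cons.mpr ⟨X_mem_maximalIdeal R, ?_⟩
      simpa only [List.forall_mem_map, ← constantCoeff_mem_maximalIdeal_iff, constantCoeff_C]
        using hmem
    · simpa [key, Function.comp_def] using hrs

end PowerSeries

theorem almostCM_iff_powerSeries {A : Type*} [CommRing A] [IsNoetherianRing A] [IsLocalRing A] :
    IsAlmostCM A ↔ IsAlmostCM (PowerSeries A) := by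
  rw [IsAlmostCM, IsAlmostCM, PowerSeries.ringKrullDim_eq_add_one,
    PowerSeries.ringDepth_eq_add_one, ← add_assoc, WithBot.coe_add (1 + ringDepth A) 1,
    WithBot.coe_one]
  exact (ENat.WithBot.add_le_add_one_right_iff).symm
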